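/- There exists a finitely presented semigroup H with zero and a generator L ∈ H such that: (i) the ideal LH is infinite (hence not nilpotent), and (ii) for all nonempty elements X, Y, Z of H, one has L·X·Y·Y·Z = 0; i.e., every element of LH containing a square of a nonempty word is zero. -/

import Mathlib

/-- The free monoid with zero on `n` letters. -/
abbrev FW (n : ℕ) := WithZero (FreeMonoid (Fin n))

/-- A word as an element of the free monoid with zero. -/
def wd {n : ℕ} (l : List (Fin n)) : FW n :=
  ((FreeMonoid.ofList l : FreeMonoid (Fin n)) : FW n)

/-- The relation generated by a finite list of defining relations, each of the form
`u = v` (second component `some v`) or `u = 0` (second component `none`). -/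
def baseRel {n : ℕ} (rels : List (List (Fin n) × Option (List (Fin n))))
    (x y : FW n) : Prop :=
  ∃ p ∈ rels, x = wd p.1 ∧ y = p.2.elim 0 wd

namespace SquareFreeIdeal

/-- The paperfolding bit of `n`: whether the odd part of `n` is `3` modulo `4`. -/
def fold (n : ℕ) : Bool :=
  if n = 0 then false
  else if n % 2 = 1 then decide (n % 4 = 3)
  else fold (n / 2)
decreasing_by omega

/-- The `n`-th letter of a square-free sequence: the parity of `n` and its paperfolding bit. -/
def label (n : ℕ) : Bool × Bool := (decide (n % 2 = 1), fold n)

theorem fold_of_odd {n : ℕ} (h : n % 2 = 1) : fold n = decide (n % 4 = 3) := by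
  rw [fold, if_neg (by omega), if_pos h]

theorem fold_two_mul (n : ℕ) : fold (2 * n) = fold n := by
  rcases Nat.eq_zero_or_pos n with rfl | hn
  · rfl
  · rw [fold, if_neg (by omega), if_neg (by omega)]
    congr 1
    omega

theorem exists_fold_ne (m : ℕ) (hm : 0 < m) :
    ∀ i, ∃ x, i ≤ x ∧ x < i + 2 * m ∧ fold x ≠ fold (x + 2 * m) := by
  induction m using Nat.strong_induction_on with
  | _ m ih =>
    intro i
    rcases Nat.even_or_odd' m with ⟨k, rfl | rfl⟩
    · obtain ⟨y, h1, h2, h3⟩ := ih k (by omega) (by omega) ((i + 1) / 2)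
      refine ⟨2 * y, by omega, by omega, ?_⟩
      rwa [← mul_add, fold_two_mul, fold_two_mul]
    · refine ⟨2 * (i / 2) + 1, by omega, by omega, ?_⟩
      rw [fold_of_odd (by omega), fold_of_odd (by omega)]
      simp only [ne_eq, decide_eq_decide]
      omega

/-- No two adjacent blocks of length `p` of the sequence `label` agree. -/
theorem exists_label_ne (p : ℕ) (hp : 0 < p) (i : ℕ) :
    ∃ x, i ≤ x ∧ x < i + p ∧ label x ≠ label (x + p) := by
  rcases Nat.even_or_odd' p with ⟨m, rfl | rfl⟩
  · obtain ⟨x, h1, h2, h3⟩ := exists_fold_ne m (by omega) i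
    exact ⟨x, h1, h2, fun h => h3 (congrArg Prod.snd h)⟩
  · refine ⟨i, le_rfl, by omega, fun h => ?_⟩
    have := congrArg Prod.fst h
    simp only [label, decide_eq_decide] at this
    omega

/-- The alphabet. `gate` turns raw letters into cells, and a head travelling over the cells deletes
those at odd positions after checking them; `head hi lo` has passed `2 * k + lo` cells, where `hi`
is the parity of `k`. -/
inductive Letter
  | left
  | wall
  | gate
  | raw (l : Bool × Bool)
  | cell (l : Bool × Bool)
  | head (hi lo : Bool)
  deriving DecidableEq, Fintype

open Letter

/-- The right-hand sides of the defining relations for words of length two, `none` being zero. -/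
def pairRule : Letter → Letter → Option (List Letter)
  | gate, raw l => some [cell l, gate]
  | gate, _ => none
  | head hi false, cell (true, q) => if q = hi then some [head hi true] else none
  | head _ false, cell (false, _) => none
  | head hi true, cell (false, q) => some [cell (!hi, q), head (!hi) false]
  | head _ true, cell (true, _) => none
  | a, b => some [a, b]

/-- The defining relations. -/
noncomputable def letterRels : List (List Letter × Option (List Letter)) :=
  ([left], some [wall, gate]) :: ([wall], some [wall, head false false]) ::
    (Finset.univ : Finset (Letter × Letter)).toList.map fun p => ([p.1, p.2], pairRule p.1 p.2)

section Vanishing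

variable {S : Type*} [Monoid S] {f : Letter → S} {z : S}

/-- The head that has passed `m` cells. -/
def headAt (m : ℕ) : Letter := head (decide (m / 2 % 2 = 1)) (decide (m % 2 = 1))

theorem headAt_pass (hz : ∀ x, z * x = z) (hz' : ∀ x, x * z = z)
    (hf : ∀ a b, f a * f b = (pairRule a b).elim z fun w => (w.map f).prod)
    (V : List (Bool × Bool)) : ∀ m : ℕ,
    f (headAt m) * ((V.map cell).map f).prod = z ∨
    ∃ V' : List (Bool × Bool),
      f (headAt m) * ((V.map cell).map f).prod =
        ((V'.map cell).map f).prod * f (headAt (m + V.length)) ∧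
      V'.length = (m + V.length) / 2 - m / 2 ∧
      (V' = (List.range' (m / 2 + 1) V'.length).map label →
        V = (List.range' (m + 1) V.length).map label) := by
  induction V with
  | nil => exact fun m => Or.inr ⟨[], by simp⟩
  | cons l V ih =>
    intro m
    obtain ⟨p, q⟩ := l
    have key := hf (headAt m) (cell (p, q))
    simp only [List.map_cons, List.prod_cons, ← mul_assoc]
    rw [key]
    rcases Nat.mod_two_eq_zero_or_one m with hm | hm
    · have hh : headAt m = head (decide (m / 2 % 2 = 1)) false := by simp [headAt, hm]
      have hh' : headAt (m + 1) = head (decide (m / 2 % 2 = 1)) true := by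
        simp [headAt, show (m + 1) % 2 = 1 by omega, show (m + 1) / 2 = m / 2 by omega]
      rw [hh]
      cases p with
      | false => left; simp [pairRule, hz]
      | true =>
        by_cases hq : q = decide (m / 2 % 2 = 1)
        · simp only [pairRule, if_pos hq, Option.elim_some, List.map_cons, List.map_nil,
            List.prod_cons, List.prod_nil, mul_one, ← hh']
          rcases ih (m + 1) with h | ⟨V', h1, h2, h3⟩
          · exact Or.inl h
          · refine Or.inr ⟨V', ?_, ?_, fun h => ?_⟩
            · rw [h1, List.length_cons, add_assoc, add_comm 1]
            · rw [h2, List.length_cons]; omega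
            · rw [show (m + 1) / 2 = m / 2 by omega] at h3
              rw [List.length_cons, List.range'_succ, List.map_cons, ← h3 h]
              congr 1
              rw [label, fold_of_odd (by omega), hq]
              simp only [Prod.mk.injEq, decide_eq_decide, eq_comm (a := true), decide_eq_true_eq]
              omega
        · left; simp [pairRule, hq, hz]
    · have hh : headAt m = head (decide (m / 2 % 2 = 1)) true := by simp [headAt, hm]
      have hh' : headAt (m + 1) = head (!decide (m / 2 % 2 = 1)) false := by
        simp only [headAt, Letter.head.injEq, ← decide_not, decide_eq_decide,
          decide_eq_false_iff_not]
        omega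
      rw [hh]
      cases p with
      | true => left; simp [pairRule, hz]
      | false =>
        simp only [pairRule, Option.elim_some, List.map_cons, List.map_nil,
          List.prod_cons, List.prod_nil, mul_one, ← hh', mul_assoc]
        rcases ih (m + 1) with h | ⟨V', h1, h2, h3⟩
        · exact Or.inl (by rw [h, hz'])
        · refine Or.inr ⟨(!decide (m / 2 % 2 = 1), q) :: V', ?_, ?_, fun h => ?_⟩
          · rw [h1, List.length_cons, List.map_cons, List.map_cons, List.prod_cons, mul_assoc,
              add_assoc, add_comm 1]
          · rw [List.length_cons, h2, List.length_cons]; omega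
          · rw [List.length_cons, List.range'_succ, List.map_cons, List.cons.injEq] at h
            rw [show (m + 1) / 2 = m / 2 + 1 by omega] at h3
            rw [List.length_cons, List.range'_succ, List.map_cons, ← h3 h.2]
            congr 1
            have hq := congrArg Prod.snd h.1
            rw [label, show m + 1 = 2 * (m / 2 + 1) by omega, fold_two_mul]
            simpa [label] using hq

theorem wall_mul_cells (hz : ∀ x, z * x = z) (hz' : ∀ x, x * z = z)
    (hf : ∀ a b, f a * f b = (pairRule a b).elim z fun w => (w.map f).prod)
    (hw : f wall = f wall * f (head false false)) (N : ℕ) : ∀ V : List (Bool × Bool),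
    V.length = N → f wall * ((V.map cell).map f).prod = z ∨
      V = (List.range' 1 V.length).map label := by
  induction N using Nat.strong_induction_on with
  | _ N ih =>
    intro V hV
    rcases Nat.eq_zero_or_pos N with rfl | hN
    · right; simp [List.length_eq_zero_iff.mp hV]
    · have h0 : head false false = headAt 0 := rfl
      rw [hw, h0, mul_assoc]
      rcases headAt_pass hz hz' hf V 0 with h | ⟨V', h1, h2, h3⟩
      · left; rw [h, hz']
      · rcases ih V'.length (by omega) V' rfl with h | h
        · left; rw [h1, ← mul_assoc, h, hz]
        · exact Or.inr (h3 h)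

theorem gate_mul (hz : ∀ x, z * x = z) (hz' : ∀ x, x * z = z)
    (hf : ∀ a b, f a * f b = (pairRule a b).elim z fun w => (w.map f).prod)
    (W : List Letter) :
    f gate * (W.map f).prod = z ∨ ∃ V : List (Bool × Bool), W = V.map raw ∧
      f gate * (W.map f).prod = ((V.map cell).map f).prod * f gate := by
  induction W with
  | nil => exact Or.inr ⟨[], by simp⟩
  | cons a W ih =>
    rw [List.map_cons, List.prod_cons, ← mul_assoc, hf]
    cases a with
    | raw l =>
      simp only [pairRule, Option.elim_some, List.map_cons, List.map_nil,
          List.prod_cons, List.prod_nil, mul_one, mul_assoc]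
      rcases ih with h | ⟨V, rfl, h⟩
      · left; rw [h, hz']
      · refine Or.inr ⟨l :: V, rfl, ?_⟩
        rw [h, List.map_cons, List.map_cons, List.prod_cons, mul_assoc]
    | _ => left; simp [pairRule, hz]

/-- A word beginning with `left` vanishes unless it continues with a prefix of `label`. -/
theorem left_mul (hz : ∀ x, z * x = z) (hz' : ∀ x, x * z = z)
    (hf : ∀ a b, f a * f b = (pairRule a b).elim z fun w => (w.map f).prod)
    (hw : f wall = f wall * f (head false false)) (hl : f left = f wall * f gate)
    (W : List Letter) :
    f left * (W.map f).prod = z ∨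
      W = (List.range' 1 W.length).map fun k => raw (label k) := by
  rw [hl, mul_assoc]
  rcases gate_mul hz hz' hf W with h | ⟨V, rfl, h⟩
  · left; rw [h, hz']
  · rw [h, ← mul_assoc]
    rcases wall_mul_cells hz hz' hf hw V.length V rfl with h | h
    · left; rw [h, hz]
    · right
      conv_lhs => rw [h]
      simp

end Vanishing

theorem not_square {X Y Z : List Letter} (hY : Y ≠ []) {N : ℕ} :
    X ++ Y ++ Y ++ Z ≠ (List.range' 1 N).map fun k => raw (label k) := by
  intro h
  obtain ⟨x, h1, h2, h3⟩ := exists_label_ne Y.length (List.length_pos_iff.mpr hY) (X.length + 1)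
  have hN := congrArg List.length h
  simp only [List.length_append, List.length_map, List.length_range'] at hN
  obtain ⟨k, rfl⟩ : ∃ k, x = X.length + k + 1 := ⟨x - X.length - 1, by omega⟩
  have hk : k < Y.length := by omega
  have e1 : (X ++ Y ++ Y ++ Z)[X.length + k]? = Y[k]? := by
    simp only [List.append_assoc]
    rw [List.getElem?_append_right (by omega), List.getElem?_append_left (by omega)]
    congr 1; omega
  have e2 : (X ++ Y ++ Y ++ Z)[X.length + Y.length + k]? = Y[k]? := by
    simp only [List.append_assoc]
    rw [List.getElem?_append_right (by omega), List.getElem?_append_right (by omega),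
      List.getElem?_append_left (by omega)]
    congr 1; omega
  have e3 := e1.trans e2.symm
  rw [h, List.getElem?_map, List.getElem?_map, List.getElem?_range' (by omega),
    List.getElem?_range' (by omega)] at e3
  simp only [Option.map_some, Option.some.injEq, Letter.raw.injEq] at e3
  apply h3
  convert e3 using 2 <;> omega

/-- States of the partial action which witnesses that words do not vanish. -/
inductive State
  | start
  | cells (n : ℕ)
  | raws (n : ℕ)

/-- The partial action of letters on states. -/
def act : State → Letter → Option State
  | .start, left => some (.raws 0)
  | .start, wall => some (.cells 0)
  | .cells n, gate => some (.raws n)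
  | .cells n, cell l => if l = label (n + 1) then some (.cells (n + 1)) else none
  | .cells n, head hi lo =>
      if hi = decide (n % 2 = 1) then some (.cells (2 * n + lo.toNat)) else none
  | .raws n, raw l => if l = label (n + 1) then some (.raws (n + 1)) else none
  | _, _ => none

theorem label_two_mul_add_one (n : ℕ) : label (2 * n + 1) = (true, decide (n % 2 = 1)) := by
  rw [label, fold_of_odd (by omega)]
  simp only [Prod.mk.injEq, decide_eq_decide, decide_eq_true_eq]
  omega

theorem label_two_mul_add_two (n : ℕ) : label (2 * n + 1 + 1) = (false, fold (n + 1)) := by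
  rw [label, show 2 * n + 1 + 1 = 2 * (n + 1) by ring, fold_two_mul]
  simp

theorem label_succ (n : ℕ) : label (n + 1) = (!decide (n % 2 = 1), fold (n + 1)) := by
  simp only [label, ← decide_not, Prod.mk.injEq, decide_eq_decide, and_true]
  omega

theorem decide_succ_mod_two (n : ℕ) :
    decide ((n + 1) % 2 = 1) = !decide (n % 2 = 1) := by
  simp only [← decide_not, decide_eq_decide]
  omega

theorem foldlM_act_pairRule (s : State) (a b : Letter) :
    [a, b].foldlM act s = (pairRule a b).elim none fun w => w.foldlM act s := by
  cases a with
  | gate =>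
    cases b with
    | raw l =>
      cases s with
      | cells n => by_cases h : l = label (n + 1) <;> simp [pairRule, act, h]
      | _ => rfl
    | _ => cases s <;> rfl
  | head hi lo =>
    cases b with
    | cell l =>
      obtain ⟨p, q⟩ := l
      cases s with
      | cells n =>
        by_cases h : hi = decide (n % 2 = 1)
        · cases lo <;> cases p
          · simp [pairRule, act, h, label_two_mul_add_one]
          · subst h
            by_cases hq : q = decide (n % 2 = 1) <;>
              simp [pairRule, act, hq, label_two_mul_add_one]
          · by_cases hq : q = fold (n + 1) <;>
              simp [pairRule, act, h, hq, label_two_mul_add_two, label_succ n,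
                decide_succ_mod_two, mul_add]
          · simp [pairRule, act, h, label_two_mul_add_two]
        · cases lo <;> cases p
          · simp [pairRule, act, h]
          · by_cases hq : q = hi <;> simp [pairRule, act, h, hq]
          · simp [pairRule, act, h, label_succ]
          · simp [pairRule, act, h]
      | _ => cases lo <;> cases p <;> by_cases hq : q = hi <;> simp [pairRule, act, hq]
    | _ => cases lo <;> rfl
  | _ => rfl

theorem foldlM_act_letterRels {p : List Letter × Option (List Letter)} (hp : p ∈ letterRels)
    (s : State) : p.1.foldlM act s = p.2.elim none fun w => w.foldlM act s := by
  simp only [letterRels, List.mem_cons, List.mem_map, Finset.mem_toList, Finset.mem_univ,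
    true_and] at hp
  rcases hp with rfl | rfl | ⟨⟨a, b⟩, rfl⟩
  · cases s <;> rfl
  · cases s <;> rfl
  · exact foldlM_act_pairRule s a b

theorem foldlM_act_raws (N : ℕ) : ∀ m,
    ((List.range' (m + 1) N).map fun k => raw (label k)).foldlM act (.raws m) =
      some (.raws (m + N)) := by
  induction N with
  | zero => simp
  | succ N ih =>
    intro m
    rw [List.range'_succ, List.map_cons, List.foldlM_cons]
    simp only [act, if_true, Option.bind_eq_bind, Option.bind_some]
    rw [ih, add_assoc, add_comm 1]

/-- An enumeration of the alphabet. -/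
noncomputable def enum : Letter ≃ Fin (Fintype.card Letter) := Fintype.equivFin Letter

/-- The defining relations over the enumerated alphabet. -/
noncomputable def rels :
    List (List (Fin (Fintype.card Letter)) × Option (List (Fin (Fintype.card Letter)))) :=
  letterRels.map fun p => (p.1.map enum, p.2.map (List.map enum))

/-- The partial action of the free monoid with zero. -/
noncomputable def run (x : FW (Fintype.card Letter)) (s : State) : Option State :=
  WithZero.recZeroCoe (motive := fun _ => Option State) none
    (fun w => ((FreeMonoid.toList w).map enum.symm).foldlM act s) x

theorem run_zero (s : State) : run 0 s = none := rfl

theorem run_wd (l : List Letter) (s : State) : run (wd (l.map enum)) s = l.foldlM act s := by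
  change ((l.map enum).map enum.symm).foldlM act s = _
  simp

theorem run_mul (x y : FW (Fintype.card Letter)) (s : State) :
    run (x * y) s = (run x s).bind (run y) := by
  induction x using WithZero.recZeroCoe with
  | zero => rw [zero_mul, run_zero]; rfl
  | coe x =>
    induction y using WithZero.recZeroCoe with
    | zero => rw [mul_zero, run_zero]; cases run (x : FW _) s <;> rfl
    | coe y =>
      change ((FreeMonoid.toList (x * y)).map enum.symm).foldlM act s = _
      rw [FreeMonoid.toList_mul, List.map_append, List.foldlM_append]
      rfl

/-- The congruence of acting in the same way on states. -/
noncomputable def runCon : Con (FW (Fintype.card Letter)) where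
  r x y := ∀ s, run x s = run y s
  iseqv := ⟨fun _ _ => rfl, fun h s => (h s).symm, fun h h' s => (h s).trans (h' s)⟩
  mul' {a b c d} h h' s := by
    rw [run_mul, run_mul, h s]
    congr 1
    exact funext h'

theorem run_eq_of_mk'_eq {x y : FW (Fintype.card Letter)}
    (h : (conGen (baseRel rels)).mk' x = (conGen (baseRel rels)).mk' y) (s : State) :
    run x s = run y s := by
  have hle : conGen (baseRel rels) ≤ runCon := by
    refine Con.conGen_le.mpr ?_
    rintro _ _ ⟨p, hp, rfl, rfl⟩ s
    obtain ⟨r, hr, rfl⟩ := List.mem_map.mp hp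
    have := foldlM_act_letterRels hr s
    rw [run_wd, this]
    rcases r with ⟨u, _ | v⟩
    · rfl
    · exact (run_wd v s).symm
  exact hle ((Con.eq _).mp h) s

theorem mk'_wd (l : List Letter) :
    (conGen (baseRel rels)).mk' (wd (l.map enum)) =
      (l.map fun a => (conGen (baseRel rels)).mk' (wd [enum a])).prod := by
  induction l with
  | nil => exact map_one _
  | cons a l ih =>
    rw [List.map_cons, List.map_cons, List.prod_cons, ← ih, ← map_mul]
    rfl

theorem mk'_rel {p : List Letter × Option (List Letter)} (hp : p ∈ letterRels) :
    (p.1.map fun a => (conGen (baseRel rels)).mk' (wd [enum a])).prod =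
      p.2.elim ((conGen (baseRel rels)).mk' 0)
        fun w => (w.map fun a => (conGen (baseRel rels)).mk' (wd [enum a])).prod := by
  have h : (conGen (baseRel rels)).mk' (wd (p.1.map enum)) =
      (conGen (baseRel rels)).mk' ((p.2.map (List.map enum)).elim 0 wd) :=
    (Con.eq _).mpr (ConGen.Rel.of _ _ ⟨_, List.mem_map_of_mem hp, rfl, rfl⟩)
  rw [← mk'_wd, h]
  rcases p with ⟨u, _ | v⟩
  · rfl
  · exact mk'_wd v

theorem mk'_left_eq_zero {X Y Z : List Letter} (hY : Y ≠ []) :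
    (conGen (baseRel rels)).mk' (wd ((left :: (X ++ Y ++ Y ++ Z)).map enum)) =
      (conGen (baseRel rels)).mk' 0 := by
  have hpair : ∀ a b : Letter, ([a, b], pairRule a b) ∈ letterRels := fun a b =>
    List.mem_cons_of_mem _ (List.mem_cons_of_mem _
      (List.mem_map.mpr ⟨(a, b), Finset.mem_toList.mpr (Finset.mem_univ _), rfl⟩))
  rw [mk'_wd, List.map_cons, List.prod_cons]
  refine (left_mul (f := fun a => (conGen (baseRel rels)).mk' (wd [enum a]))
    (fun x => ?_) (fun x => ?_) (fun a b => ?_) ?_ ?_ _).resolve_right (not_square hY)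
  · obtain ⟨x, rfl⟩ := Con.mk'_surjective x
    rw [← map_mul, zero_mul]
  · obtain ⟨x, rfl⟩ := Con.mk'_surjective x
    rw [← map_mul, mul_zero]
  · simpa using mk'_rel (hpair a b)
  · simpa using mk'_rel (p := ([wall], some [wall, head false false])) (by simp [letterRels])
  · simpa using mk'_rel (p := ([left], some [wall, gate])) (by simp [letterRels])

/-- The word `left` followed by the first `N` raw letters of the sequence `label`. -/
def prefixWord (N : ℕ) : List Letter :=
  left :: (List.range' 1 N).map fun k => raw (label k)

theorem run_prefixWord (N : ℕ) :
    run (wd ((prefixWord N).map enum)) .start = some (.raws N) := by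
  rw [run_wd, prefixWord, List.foldlM_cons]
  simpa [act] using foldlM_act_raws N 0

end SquareFreeIdeal

open SquareFreeIdeal

/-- there exist a finite alphabet, a finite list of defining relations,
and a generator `Lx` such that in the resulting finitely presented semigroup with zero:
(i) the set of nonzero elements of the form `Lx·A` is infinite, and
(ii) `Lx·X·Y·Y·Z = 0` for all nonempty words `X, Y, Z`. -/
theorem stmt15 :
    ∃ (n : ℕ) (rels : List (List (Fin n) × Option (List (Fin n)))) (Lx : Fin n),
      (Set.Infinite {x : (conGen (baseRel rels)).Quotient |
          x ≠ (conGen (baseRel rels)).mk' 0 ∧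
          ∃ A : List (Fin n), x = (conGen (baseRel rels)).mk' (wd (Lx :: A))}) ∧
      (∀ X Y Z : List (Fin n), X ≠ [] → Y ≠ [] → Z ≠ [] →
        (conGen (baseRel rels)).mk' (wd (Lx :: (X ++ Y ++ Y ++ Z))) =
          (conGen (baseRel rels)).mk' 0) := by
  refine ⟨Fintype.card Letter, rels, enum .left, ?_, fun X Y Z _ hY _ => ?_⟩
  · refine Set.infinite_of_injective_forall_mem
      (f := fun N => (conGen (baseRel rels)).mk' (wd ((prefixWord N).map enum)))
      (fun N N' h => ?_) (fun N => ⟨fun h => ?_, _, rfl⟩)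
    · have := run_eq_of_mk'_eq h .start
      rw [run_prefixWord, run_prefixWord] at this
      simpa using this
    · have := run_eq_of_mk'_eq h .start
      rw [run_prefixWord, run_zero] at this
      simp at this
  · have := mk'_left_eq_zero (X := X.map enum.symm) (Y := Y.map enum.symm)
      (Z := Z.map enum.symm) (by simpa using hY)
    simpa [Function.comp_def] using this
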